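/- For any continuous map T of a compact metric space X, if Y ⊆ X has full measure for every T-invariant Borel probability measure (totally full measure), then the Bowen topological entropy of Y equals the topological entropy of T. -/

import Mathlib

open MeasureTheory Filter Set Metric Topology NNReal ENNReal

noncomputable section

variable {X : Type*} [MetricSpace X] [CompactSpace X] [MeasurableSpace X] [BorelSpace X]

/-- Bowen dynamical ball of order `m` and radius `ε`. -/
def bowenBall (T : X → X) (x : X) (m : ℕ) (ε : ℝ) : Set X :=
  {y | ∀ j < m, dist (T^[j] x) (T^[j] y) ≤ ε}

/-- Weight `2 ^ (-t·m)` of an entry of a Bowen cover (`none` entries weigh `0`). -/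
def bowenWeight (t : ℝ≥0) (c : Option (X × ℕ)) : ℝ≥0∞ :=
  c.elim 0 fun p => (2 : ℝ≥0∞) ^ (-((t : ℝ) * (p.2 : ℝ)))

/-- A finite or countable cover of `E` by Bowen balls of order at least `n`. -/
def IsBowenCover (T : X → X) (E : Set X) (n : ℕ) (ε : ℝ)
    (c : ℕ → Option (X × ℕ)) : Prop :=
  (∀ i p, c i = some p → n ≤ p.2) ∧
    E ⊆ ⋃ i, (c i).elim ∅ fun p => bowenBall T p.1 p.2 ε

/-- The quantity `C(E; t, n, ε)` of Bowen. -/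
def bowenC (T : X → X) (E : Set X) (t : ℝ≥0) (n : ℕ) (ε : ℝ) : ℝ≥0∞ :=
  ⨅ (c : ℕ → Option (X × ℕ)) (_ : IsBowenCover T E n ε c), ∑' i, bowenWeight t (c i)

/-- Bowen entropy of `E` at scale `ε`: the critical exponent `t` at which
`C(E; t, ε) = lim_n C(E; t, n, ε)` vanishes. -/
def bowenEntropyOf (T : X → X) (E : Set X) (ε : ℝ) : ℝ≥0∞ :=
  ⨅ t : {t : ℝ≥0 // ⨆ n, bowenC T E t n ε = 0}, (t.1 : ℝ≥0∞)

/-- Bowen (dimension-like) topological entropy of an arbitrary subset `E ⊆ X`.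
For `E = univ` this is the topological entropy of `T`. -/
def bowenEntropy (T : X → X) (E : Set X) : ℝ≥0∞ :=
  ⨆ (ε : ℝ) (_ : 0 < ε), bowenEntropyOf T E ε

/-- Birkhoff average `(1/n) ∑_{i<n} φ(T^i x)`. -/
def birkhoffAvg (T : X → X) (φ : X → ℝ) (x : X) (n : ℕ) : ℝ :=
  (∑ i ∈ Finset.range n, φ (T^[i] x)) / n

/-- `x` is a generic point for `μ`: the empirical measures `Υ_n(x)` converge to `μ`
in the weak* topology, i.e. Birkhoff averages of every continuous function converge
to the corresponding integral. -/
def genericFor (T : X → X) (x : X) (μ : Measure X) : Prop :=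
  ∀ φ : X → ℝ, Continuous φ →
    Tendsto (fun n => birkhoffAvg T φ x n) atTop (𝓝 (∫ y, φ y ∂μ))

/-- `ρ` is a weak* limit point of the sequence of empirical measures of `x`,
i.e. `ρ ∈ M_x(T)`. -/
def limitMeasure (T : X → X) (x : X) (ρ : Measure X) : Prop :=
  ∃ n : ℕ → ℕ, StrictMono n ∧ ∀ φ : X → ℝ, Continuous φ →
    Tendsto (fun k => birkhoffAvg T φ x (n k)) atTop (𝓝 (∫ y, φ y ∂ρ))

/-- The (topological) support of a measure on a metric space. -/
def measSupport (μ : Measure X) : Set X := {x | ∀ ε > 0, 0 < μ (Metric.ball x ε)}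

/-- Lower visit frequency of the orbit of `x` in the set `E`. -/
def visitLiminf (T : X → X) (x : X) (E : Set X) : ℝ :=
  Filter.atTop.liminf fun n =>
    (∑ i ∈ Finset.range n, E.indicator (fun _ => (1 : ℝ)) (T^[i] x)) / n

/-- Upper visit frequency of the orbit of `x` in the set `E`. -/
def visitLimsup (T : X → X) (x : X) (E : Set X) : ℝ :=
  Filter.atTop.limsup fun n =>
    (∑ i ∈ Finset.range n, E.indicator (fun _ => (1 : ℝ)) (T^[i] x)) / n

/-- Weakly almost periodic points `W(T)`. -/
def weaklyAlmostPeriodicPts (T : X → X) : Set X :=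
  {x | ∀ ε > 0, 0 < visitLiminf T x (Metric.ball x ε)}

/-- Quasi-weakly almost periodic points `QW(T)`. -/
def quasiWeaklyAlmostPeriodicPts (T : X → X) : Set X :=
  {x | ∀ ε > 0, 0 < visitLimsup T x (Metric.ball x ε)}

/-- Recurrent points: `x ∈ ω_T(x)`. -/
def recurrentPts (T : X → X) : Set X :=
  {x | ∀ ε > 0, ∃ n ≥ 1, dist (T^[n] x) x < ε}

/-- Quasiregular points `QR(T)`: points generic for some invariant Borel probability
measure. -/
def quasiRegularPts (T : X → X) : Set X :=
  {x | ∃ μ : Measure X, IsProbabilityMeasure μ ∧ μ.map T = μ ∧ genericFor T x μ}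

/-- A (compact) minimal set: nonempty, closed, invariant, and every orbit in it is
dense in it. -/
def IsMinimalSet (T : X → X) (K : Set X) : Prop :=
  K.Nonempty ∧ IsClosed K ∧ Set.MapsTo T K K ∧
    ∀ y ∈ K, closure (Set.range fun n => T^[n] y) = K

/-- Almost periodic points `A(T)`: points lying in a compact minimal invariant set. -/
def almostPeriodicPts (T : X → X) : Set X :=
  {x | ∃ K, IsMinimalSet T K ∧ x ∈ K}

/-- Entropy `H(μ, ⋁_{k<n} T^{-k}ξ)` of the `n`-th dynamical refinement of the finite
partition coded by `p`. -/
def partitionDynEntropy (T : X → X) (μ : Measure X) (p : X → ℕ) (n : ℕ) : ℝ≥0∞ :=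
  ∑' f : Fin n → ℕ,
    ENNReal.ofReal (Real.negMulLog ((μ {x | ∀ k : Fin n, p (T^[(k : ℕ)] x) = f k}).toReal))

/-- Kolmogorov–Sinai (metric) entropy of `μ`: supremum over finite measurable
partitions of the exponential growth rate of the refined partition entropies. -/
def metricEntropy (T : X → X) (μ : Measure X) : ℝ≥0∞ :=
  ⨆ p : {p : X → ℕ // Measurable p ∧ (Set.range p).Finite},
    Filter.atTop.limsup fun n => partitionDynEntropy T μ p.1 n / (n : ℝ≥0∞)

/-- The periodic measure: uniform measure on the (periodic) orbit segment of length
`n` of `x`. -/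
def periodicOrbitMeasure (T : X → X) (x : X) (n : ℕ) : Measure X :=
  (n : ℝ≥0∞)⁻¹ • ∑ i ∈ Finset.range n, Measure.dirac (T^[i] x)

/-- Regular points `R(T) = ⋃_{μ ergodic} (G_μ ∩ supp μ)`. -/
def regularPts (T : X → X) : Set X :=
  {x | ∃ μ : Measure X, IsProbabilityMeasure μ ∧ Ergodic T μ ∧
    genericFor T x μ ∧ x ∈ measSupport μ}

/-- The set of integrals `∫ φ dμ` over all invariant Borel probability measures;
its infimum and supremum are the endpoints of the interval `L_φ`. -/
def invIntegralSet (T : X → X) (φ : X → ℝ) : Set ℝ :=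
  {r | ∃ μ : Measure X, IsProbabilityMeasure μ ∧ μ.map T = μ ∧ (∫ y, φ y ∂μ) = r}

/-- The entropy spectrum `Ψ(a) = sup {h_ρ(T) : ρ invariant, ∫φ dρ = a}`. -/
def entSpectrum (T : X → X) (φ : X → ℝ) (a : ℝ) : ℝ≥0∞ :=
  ⨆ (ρ : Measure X) (_ : IsProbabilityMeasure ρ ∧ ρ.map T = ρ ∧ (∫ y, φ y ∂ρ) = a),
    metricEntropy T ρ

open Classical in
/-- Number of visits to `K` among the first `n` times. -/
def visN (T : X → X) (K : Set X) (n : ℕ) (x : X) : ℕ :=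
  ∑ j ∈ Finset.range n, if T^[j] x ∈ K then 1 else 0

/-- `E` is covered by countably many sets which are `r`-small for `m i ≥ n` steps, with total
weight at most `w`. -/
def HasCov (T : X → X) (r : ℝ) (t : ℝ≥0) (E : Set X) (n : ℕ) (w : ℝ≥0∞) : Prop :=
  ∃ (ι : Type) (_ : Countable ι) (A : ι → Set X) (m : ι → ℕ),
    (∀ i, n ≤ m i) ∧
    (∀ i, ∀ x ∈ A i, ∀ y ∈ A i, ∀ j < m i, dist (T^[j] x) (T^[j] y) ≤ r) ∧
    E ⊆ ⋃ i, A i ∧ ∑' i, (2 : ℝ≥0∞) ^ (-((t : ℝ) * (m i : ℝ))) ≤ w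

theorem visN_succ_step (T : X → X) (K : Set X) (n : ℕ) (x : X) :
    visN T K n (T x) ≤ visN T K (n + 1) x := by
  unfold visN
  rw [Finset.sum_range_succ']
  simp only [Function.iterate_succ_apply]
  exact Nat.le_add_right _ _

theorem visN_succ_mem (T : X → X) (K : Set X) (n : ℕ) (x : X) (hx : x ∈ K) :
    visN T K n (T x) + 1 = visN T K (n + 1) x := by
  unfold visN
  rw [Finset.sum_range_succ']
  simp only [Function.iterate_succ_apply, Function.iterate_zero, id, hx, if_true]
  congr!

theorem visN_sub (T : X → X) (K : Set X) (m : ℕ) : ∀ (n : ℕ) (x : X),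
    visN T K (n - m) (T^[m] x) ≤ visN T K n x := by
  induction m with
  | zero => intro n x; simp
  | succ m ih =>
    intro n x
    cases n with
    | zero => simp [visN]
    | succ n =>
      rw [Nat.succ_sub_succ, Function.iterate_succ_apply]
      exact (ih n (T x)).trans (visN_succ_step T K n x)

theorem two_rpow_add (a b : ℝ) : (2 : ℝ≥0∞) ^ (a + b) = 2 ^ a * 2 ^ b :=
  ENNReal.rpow_add _ _ (by norm_num) (by norm_num)

theorem HasCov.comb (T : X → X) (r : ℝ) (t : ℝ≥0) (n : ℕ) {κ : Type} [Countable κ]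
    (U : κ → Set X) (l : κ → ℕ) (F : κ → Set X) (w : κ → ℝ≥0∞)
    (hU : ∀ k, ∀ x ∈ U k, ∀ y ∈ U k, ∀ j < l k, dist (T^[j] x) (T^[j] y) ≤ r)
    (hF : ∀ k, HasCov T r t (F k) (n - l k) (w k)) (E : Set X)
    (hE : ∀ x ∈ E, ∃ k, x ∈ U k ∧ T^[l k] x ∈ F k) :
    HasCov T r t E n (∑' k, (2 : ℝ≥0∞) ^ (-((t : ℝ) * (l k : ℝ))) * w k) := by
  choose ι hι A m hm hA hFA hw using hF
  refine ⟨Σ k, ι k, inferInstance, fun p => U p.1 ∩ T^[l p.1] ⁻¹' A p.1 p.2,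
    fun p => l p.1 + m p.1 p.2, ?_, ?_, ?_, ?_⟩
  · rintro ⟨k, i⟩
    have := hm k i
    simp only
    omega
  · rintro ⟨k, i⟩ x hx y hy j hj
    simp only at hx hy hj
    by_cases h : j < l k
    · exact hU k x hx.1 y hy.1 j h
    · obtain ⟨d, rfl⟩ := Nat.exists_eq_add_of_le (not_lt.mp h)
      have := hA k i _ hx.2 _ hy.2 d (by omega)
      rwa [← Function.iterate_add_apply, ← Function.iterate_add_apply, add_comm d] at this
  · intro x hx
    obtain ⟨k, h1, h2⟩ := hE x hx
    obtain ⟨i, hi⟩ := mem_iUnion.mp (hFA k h2)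
    exact mem_iUnion.mpr ⟨⟨k, i⟩, h1, hi⟩
  · rw [ENNReal.tsum_sigma']
    refine ENNReal.tsum_le_tsum fun k => ?_
    refine le_trans (le_of_eq ?_) (mul_le_mul_right (hw k) _)
    rw [← ENNReal.tsum_mul_left]
    refine tsum_congr fun i => ?_
    rw [← two_rpow_add]
    push_cast
    ring_nf

theorem HasCov.bowenC_le {T : X → X} {r : ℝ} {t : ℝ≥0} {E : Set X} {n : ℕ} {w : ℝ≥0∞}
    (h : HasCov T r t E n w) (η : ℝ≥0) :
    bowenC T E (t + η) n r ≤ (2 : ℝ≥0∞) ^ (-((η : ℝ) * (n : ℝ))) * w := by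
  classical
  obtain ⟨ι, hι, A, m, hm, hA, hE, hw⟩ := h
  obtain ⟨_⟩ := nonempty_encodable ι
  let g : ι → Option (X × ℕ) := fun i => if h : (A i).Nonempty then some (h.some, m i) else none
  let c : ℕ → Option (X × ℕ) := fun k => (Encodable.decode₂ ι k).bind g
  have hc : ∀ i, c (Encodable.encode i) = g i := by intro i; simp [c]
  have hcov : IsBowenCover T E n r c := by
    constructor
    · intro k p hk
      simp only [c, Option.bind_eq_some_iff] at hk
      obtain ⟨i, -, hi⟩ := hk
      simp only [g] at hi
      split_ifs at hi
      simp only [Option.some.injEq] at hi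
      rw [← hi]
      exact hm i
    · intro x hx
      obtain ⟨i, hi⟩ := mem_iUnion.mp (hE hx)
      refine mem_iUnion.mpr ⟨Encodable.encode i, ?_⟩
      have hne : (A i).Nonempty := ⟨x, hi⟩
      rw [hc]
      simp only [g, hne, dif_pos, Option.elim]
      exact fun j hj => hA i _ hne.some_mem _ hi j hj
  refine (iInf₂_le c hcov).trans ?_
  have hsupp : Function.support (fun k => bowenWeight (t + η) (c k)) ⊆
      Set.range (Encodable.encode : ι → ℕ) := by
    intro k hk
    by_contra hcon
    apply hk
    have : c k = none := by
      have : Encodable.decode₂ ι k = none := by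
        by_contra h0
        obtain ⟨i, hi⟩ := Option.ne_none_iff_exists'.mp h0
        exact hcon ⟨i, Encodable.decode₂_eq_some.mp hi⟩
      simp [c, this]
    simp [this, bowenWeight]
  rw [← Function.Injective.tsum_eq Encodable.encode_injective hsupp]
  refine le_trans ?_ (mul_le_mul_right hw _)
  rw [← ENNReal.tsum_mul_left]
  refine ENNReal.tsum_le_tsum fun i => ?_
  rw [hc]
  simp only [g]
  split_ifs with h
  · simp only [bowenWeight, Option.elim]
    rw [← two_rpow_add]
    apply ENNReal.rpow_le_rpow_of_exponent_le (by norm_num)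
    have : (n : ℝ) ≤ m i := by exact_mod_cast hm i
    have h2 := mul_le_mul_of_nonneg_left this η.2
    push_cast
    simp only [NNReal.val_eq_coe] at h2
    nlinarith
  · simp [bowenWeight]

/-- Main counting estimate. -/
theorem hasCov_vis (T : X → X) (r : ℝ) (t : ℝ≥0) (K : Set X) {κ : Type} [Countable κ]
    (U : κ → Set X) (l : κ → ℕ) (hl : ∀ k, 1 ≤ l k)
    (hU : ∀ k, ∀ x ∈ U k, ∀ y ∈ U k, ∀ j < l k, dist (T^[j] x) (T^[j] y) ≤ r)
    (hS : ∑' k, (2 : ℝ≥0∞) ^ (-((t : ℝ) * (l k : ℝ))) ≤ 2⁻¹)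
    (hK : ∀ x ∉ K, ∃ k, x ∈ U k)
    (M : ℕ) (hM : 1 ≤ M) (V : Fin M → Set X)
    (hV : ∀ v, ∀ x ∈ V v, ∀ y ∈ V v, dist x y ≤ r) (hVc : ∀ x, ∃ v, x ∈ V v) :
    ∀ n b : ℕ, HasCov T r t {x | visN T K n x ≤ b} n ((2 * M : ℝ≥0∞) ^ b) := by
  intro n
  induction n using Nat.strong_induction_on with
  | _ n ih =>
  intro b
  have hM1 : (1 : ℝ≥0∞) ≤ 2 * M := by
    have : (1 : ℕ) ≤ 2 * M := by omega
    exact_mod_cast this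
  rcases n with _ | n
  · exact ⟨Unit, inferInstance, fun _ => univ, fun _ => 0, by simp, by simp, by simp [iUnion_const],
      by simpa using one_le_pow₀ hM1⟩
  have hw : ∃ w : ℝ≥0∞, HasCov T r t {x | visN T K n x + 1 ≤ b} n w ∧
      (M : ℝ≥0∞) * w ≤ 2⁻¹ * (2 * M : ℝ≥0∞) ^ b := by
    rcases b with _ | b
    · exact ⟨0, ⟨Empty, inferInstance, fun _ => ∅, fun _ => 0, by simp, by simp, by simp,
        by simp⟩, by simp⟩
    · refine ⟨_, by simpa using ih n (by omega) b, le_of_eq ?_⟩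
      rw [pow_succ', ← mul_assoc, ← mul_assoc, ENNReal.inv_mul_cancel (by norm_num) (by norm_num),
        one_mul]
  obtain ⟨w, hw1, hw2⟩ := hw
  have key := HasCov.comb T r t (n + 1) (κ := κ ⊕ Fin M) (Sum.elim U V) (Sum.elim l fun _ => 1)
    (Sum.elim (fun k => {x | visN T K (n + 1 - l k) x ≤ b}) fun _ => {x | visN T K n x + 1 ≤ b})
    (Sum.elim (fun _ => (2 * M : ℝ≥0∞) ^ b) fun _ => w) ?_ ?_ {x | visN T K (n + 1) x ≤ b} ?_
  · obtain ⟨ι, hι, A, m, h1, h2, h3, h4⟩ := key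
    refine ⟨ι, hι, A, m, h1, h2, h3, h4.trans ?_⟩
    rw [Summable.tsum_sum ENNReal.summable ENNReal.summable]
    simp only [Sum.elim_inl, Sum.elim_inr, ENNReal.tsum_mul_right]
    calc _ ≤ 2⁻¹ * (2 * M : ℝ≥0∞) ^ b + M * w := by
          refine add_le_add (mul_le_mul_left hS _) (mul_le_mul_left ?_ _)
          rw [tsum_fintype]
          refine (Finset.sum_le_card_nsmul _ _ 1 fun v _ => ?_).trans (by simp)
          refine (ENNReal.rpow_le_rpow_of_exponent_le (by norm_num)
            (show -((t : ℝ) * ((1 : ℕ) : ℝ)) ≤ 0 by simp)).trans (by simp)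
      _ ≤ 2⁻¹ * (2 * M : ℝ≥0∞) ^ b + 2⁻¹ * (2 * M : ℝ≥0∞) ^ b := by gcongr
      _ = _ := by rw [← add_mul, ENNReal.inv_two_add_inv_two, one_mul]
  · rintro (k | v)
    · exact hU k
    · intro x hx y hy j hj
      simp only [Sum.elim_inr, Nat.lt_one_iff] at hj
      subst hj
      exact hV v x hx y hy
  · rintro (k | v)
    · exact ih _ (by have := hl k; omega) b
    · exact hw1
  · intro x hx
    by_cases hxK : x ∈ K
    · obtain ⟨v, hv⟩ := hVc x
      refine ⟨Sum.inr v, hv, ?_⟩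
      have := visN_succ_mem T K n x hxK
      simp only [mem_ofPred_eq] at hx
      simp only [Sum.elim_inr, mem_ofPred_eq, Function.iterate_one]
      omega
    · obtain ⟨k, hk⟩ := hK x hxK
      exact ⟨Sum.inl k, hk, (visN_sub T K (l k) (n + 1) x).trans hx⟩

theorem periodicOrbitMeasure_prob (T : X → X) (x : X) (n : ℕ) (hn : 1 ≤ n) :
    IsProbabilityMeasure (periodicOrbitMeasure T x n) := by
  constructor
  simp only [periodicOrbitMeasure, Measure.smul_apply, Measure.finsetSum_apply, measure_univ,
    Finset.sum_const, Finset.card_range, smul_eq_mul, nsmul_eq_mul, mul_one]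
  exact ENNReal.inv_mul_cancel (by simp; omega) (by simp)

theorem periodicOrbitMeasure_integral (T : X → X) (x : X) (n : ℕ) (f : X → ℝ)
    (hf : Continuous f) :
    ∫ y, f y ∂(periodicOrbitMeasure T x n) = (n : ℝ)⁻¹ * ∑ i ∈ Finset.range n, f (T^[i] x) := by
  unfold periodicOrbitMeasure
  rw [integral_smul_measure, integral_finsetSum_measure]
  · simp
  · intro i _
    exact integrable_dirac' hf.stronglyMeasurable (by simp)

theorem periodicOrbitMeasure_closed (T : X → X) (x : X) (n : ℕ) (K : Set X) (hK : IsClosed K) :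
    periodicOrbitMeasure T x n K = (n : ℝ≥0∞)⁻¹ * (visN T K n x : ℕ) := by
  classical
  simp only [periodicOrbitMeasure, Measure.smul_apply, Measure.finsetSum_apply, smul_eq_mul, visN,
    Nat.cast_sum]
  congr 1
  refine Finset.sum_congr rfl fun i _ => ?_
  rw [Measure.dirac_apply' _ hK.measurableSet]
  by_cases h : T^[i] x ∈ K <;> simp [h]

/-- A closed set which is null for all invariant measures has uniformly small visit frequency. -/
theorem visits_small (T : X → X) (hT : Continuous T) (K : Set X) (hK : IsClosed K)
    (h0 : ∀ μ : Measure X, IsProbabilityMeasure μ → μ.map T = μ → μ K = 0) (δ : ℝ) (hδ : 0 < δ) :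
    ∃ N : ℕ, ∀ n ≥ N, ∀ x, (visN T K n x : ℝ) ≤ δ * n := by
  by_contra hcon
  push Not at hcon
  choose n hn x hx using fun N : ℕ => hcon (N + 1)
  have hn1 : ∀ k, 1 ≤ n k := fun k => le_trans (by omega) (hn k)
  let μs : ℕ → ProbabilityMeasure X := fun k =>
    ⟨periodicOrbitMeasure T (x k) (n k), periodicOrbitMeasure_prob T _ _ (hn1 k)⟩
  obtain ⟨μ, φ, hφ, hlim⟩ := CompactSpace.tendsto_subseq μs
  have hint := ProbabilityMeasure.tendsto_iff_forall_integral_tendsto.mp hlim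
  have hinv : (μ : Measure X).map T = μ := by
    have : IsProbabilityMeasure ((μ : Measure X).map T) :=
      Measure.isProbabilityMeasure_map hT.aemeasurable
    apply ext_of_forall_integral_eq_of_IsFiniteMeasure
    intro f
    rw [integral_map hT.aemeasurable f.continuous.aestronglyMeasurable]
    have h1 := hint f
    have h2 := hint (f.compContinuous ⟨T, hT⟩)
    have h3 : Tendsto (fun k => ((n (φ k) : ℝ))⁻¹ * (2 * ‖f‖)) atTop (𝓝 0) := by
      have : Tendsto (fun k => (n (φ k) : ℝ)) atTop atTop := by
        refine tendsto_natCast_atTop_atTop.comp (tendsto_atTop_mono (fun k => ?_) tendsto_id)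
        have := hn (φ k)
        have := hφ.id_le k
        simp only [id] at *
        omega
      simpa using this.inv_tendsto_atTop.mul_const (2 * ‖f‖)
    have h4 : Tendsto (fun k => ∫ ω, (f.compContinuous ⟨T, hT⟩) ω ∂((μs ∘ φ) k : Measure X) -
        ∫ ω, f ω ∂((μs ∘ φ) k : Measure X)) atTop (𝓝 0) := by
      refine squeeze_zero_norm (fun k => ?_) h3
      have e1 := periodicOrbitMeasure_integral T (x (φ k)) (n (φ k)) f f.continuous
      have e2 := periodicOrbitMeasure_integral T (x (φ k)) (n (φ k))
        (f.compContinuous ⟨T, hT⟩) (f.compContinuous ⟨T, hT⟩).continuous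
      change ‖∫ ω, (f.compContinuous ⟨T, hT⟩) ω ∂(periodicOrbitMeasure T (x (φ k)) (n (φ k))) -
        ∫ ω, f ω ∂(periodicOrbitMeasure T (x (φ k)) (n (φ k)))‖ ≤ _
      rw [e1, e2, ← mul_sub, ← Finset.sum_sub_distrib]
      have e3 : ∀ i, (f.compContinuous ⟨T, hT⟩) (T^[i] (x (φ k))) - f (T^[i] (x (φ k))) =
          f (T^[i + 1] (x (φ k))) - f (T^[i] (x (φ k))) := by
        intro i
        rw [Function.iterate_succ_apply']
        rfl
      simp only [e3]
      rw [Finset.sum_range_sub (fun i => f (T^[i] (x (φ k)))), norm_mul, norm_inv,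
        Real.norm_natCast]
      refine mul_le_mul_of_nonneg_left ?_ (by positivity)
      refine (norm_sub_le _ _).trans ?_
      have a1 := f.norm_coe_le_norm (T^[n (φ k)] (x (φ k)))
      have a2 := f.norm_coe_le_norm (T^[0] (x (φ k)))
      linarith
    have h5 := tendsto_nhds_unique h4 (h2.sub h1)
    have h6 : ∫ x, f (T x) ∂(μ : Measure X) - ∫ x, f x ∂(μ : Measure X) = 0 := h5.symm
    linarith
  have hK0 := h0 μ inferInstance hinv
  have hle := ProbabilityMeasure.limsup_measure_closed_le_of_tendsto hlim hK
  rw [hK0] at hle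
  have hge : ENNReal.ofReal δ ≤ limsup (fun k => ((μs ∘ φ) k : Measure X) K) atTop := by
    refine le_limsup_of_frequently_le' (Frequently.of_forall fun k => ?_)
    change _ ≤ periodicOrbitMeasure T (x (φ k)) (n (φ k)) K
    rw [periodicOrbitMeasure_closed T _ _ K hK]
    have hpos : (0 : ℝ) < n (φ k) := by exact_mod_cast hn1 (φ k)
    have h1 := (hx (φ k)).le
    rw [← ENNReal.ofReal_natCast, ← ENNReal.ofReal_natCast, ← ENNReal.ofReal_inv_of_pos hpos,
      ← ENNReal.ofReal_mul (by positivity)]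
    apply ENNReal.ofReal_le_ofReal
    rw [inv_mul_eq_div, le_div_iff₀ hpos]
    exact h1
  have : ENNReal.ofReal δ ≤ 0 := hge.trans hle
  rw [nonpos_iff_eq_zero, ENNReal.ofReal_eq_zero] at this
  linarith

theorem bowenC_mono_n (T : X → X) (E : Set X) (t : ℝ≥0) (ε : ℝ) {n nn : ℕ} (h : n ≤ nn) :
    bowenC T E t n ε ≤ bowenC T E t nn ε :=
  le_iInf₂ fun c hc => iInf₂_le c ⟨fun i p hp => h.trans (hc.1 i p hp), hc.2⟩

theorem bowenC_mono_set (T : X → X) {E F : Set X} (hEF : E ⊆ F) (t : ℝ≥0) (ε : ℝ) (n : ℕ) :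
    bowenC T E t n ε ≤ bowenC T F t n ε :=
  le_iInf₂ fun c hc => iInf₂_le c ⟨hc.1, hEF.trans hc.2⟩

theorem bowenEntropy_mono_set (T : X → X) {E F : Set X} (hEF : E ⊆ F) :
    bowenEntropy T E ≤ bowenEntropy T F := by
  refine iSup₂_mono fun ε _ => le_iInf fun t => ?_
  refine iInf_le_of_le ⟨t.1, ?_⟩ le_rfl
  rw [← nonpos_iff_eq_zero]
  refine le_trans ?_ t.2.le
  exact iSup_mono fun n => bowenC_mono_set T hEF t.1 ε n

theorem bowenC_univ_zero (T : X → X) (hT : Continuous T) (Y : Set X)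
    (hY : ∀ μ : Measure X, IsProbabilityMeasure μ → μ.map T = μ → μ Y = 1)
    (ε : ℝ) (hε : 0 < ε) (t : ℝ≥0) (ht : ⨆ n, bowenC T Y t n ε = 0) (η : ℝ≥0) (hη : 0 < η) :
    ⨆ n, bowenC T univ (t + η) n (4 * ε) = 0 := by
  -- a good cover
  have h1 : bowenC T Y t 1 ε < 2⁻¹ := by
    have : bowenC T Y t 1 ε = 0 := by
      rw [← nonpos_iff_eq_zero, ← ht]
      exact le_iSup (fun n => bowenC T Y t n ε) 1
    rw [this]
    simp
  unfold bowenC at h1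
  simp only [iInf_lt_iff] at h1
  obtain ⟨c, hc, hcw⟩ := h1
  let κ := {i : ℕ // (c i).isSome}
  let p : κ → X × ℕ := fun k => (c k.1).get k.2
  have hp : ∀ k : κ, c k.1 = some (p k) := fun k => by simp [p]
  let U : κ → Set X := fun k => {y | ∀ j < (p k).2, dist (T^[j] (p k).1) (T^[j] y) < 2 * ε}
  have hUo : ∀ k, IsOpen (U k) := by
    intro k
    have : U k = ⋂ j ∈ Finset.range (p k).2,
        {y | dist (T^[j] (p k).1) (T^[j] y) < 2 * ε} := by
      ext y; simp [U]
    rw [this]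
    refine isOpen_biInter_finset fun j _ => ?_
    exact isOpen_lt (continuous_const.dist (hT.iterate j)) continuous_const
  have hYU : Y ⊆ ⋃ k, U k := by
    intro y hy
    obtain ⟨i, hi⟩ := mem_iUnion.mp (hc.2 hy)
    cases hci : c i with
    | none => simp [hci] at hi
    | some q =>
      have hs : (c i).isSome := by simp [hci]
      have hpq : p ⟨i, hs⟩ = q := by simp [p, hci]
      rw [hci] at hi
      refine mem_iUnion.mpr ⟨⟨i, hs⟩, ?_⟩
      intro j hj
      rw [hpq] at hj ⊢
      have := hi j hj
      linarith
  let K : Set X := (⋃ k, U k)ᶜ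
  have hKc : IsClosed K := (isOpen_iUnion hUo).isClosed_compl
  have hK0 : ∀ μ : Measure X, IsProbabilityMeasure μ → μ.map T = μ → μ K = 0 := by
    intro μ hμ hinv
    rw [prob_compl_eq_zero_iff (isOpen_iUnion hUo).measurableSet]
    exact le_antisymm prob_le_one ((hY μ hμ hinv).symm.le.trans (measure_mono hYU))
  -- finite cover by balls
  obtain ⟨s, hs⟩ := (isCompact_univ (X := X)).elim_finite_subcover
    (fun x : X => ball x (2 * ε)) (fun x => isOpen_ball)
    (fun x _ => mem_iUnion.mpr ⟨x, mem_ball_self (by positivity)⟩)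
  have hMV : ∃ M : ℕ, 1 ≤ M ∧ ∃ V : Fin M → Set X,
      (∀ v, ∀ x ∈ V v, ∀ y ∈ V v, dist x y ≤ 4 * ε) ∧ ∀ x, ∃ v, x ∈ V v := by
    let e := s.equivFin
    refine ⟨s.card + 1, by omega, fun v => if h : v.1 < s.card then
      ball (e.symm ⟨v.1, h⟩).1 (2 * ε) else ∅, ?_, ?_⟩
    · intro v x hx y hy
      by_cases h : v.1 < s.card
      · simp only [h, dif_pos] at hx hy
        have := dist_triangle_right x y (e.symm ⟨v.1, h⟩).1
        rw [mem_ball] at hx hy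
        linarith
      · simp [h] at hx
    · intro x
      obtain ⟨z, hz, hxz⟩ := mem_iUnion₂.mp (hs (mem_univ x))
      refine ⟨⟨(e ⟨z, hz⟩).1, by have := (e ⟨z, hz⟩).2; omega⟩, ?_⟩
      simp only [Fin.is_lt, dif_pos, Fin.eta, Equiv.symm_apply_apply]
      exact hxz
  obtain ⟨M, hM, V, hV, hVc⟩ := hMV
  have key := hasCov_vis T (4 * ε) t K U (fun k => (p k).2) (fun k => hc.1 k.1 _ (hp k))
    (by
      intro k x hx y hy j hj
      have a := hx j hj
      have b := hy j hj
      have := dist_triangle_left (T^[j] x) (T^[j] y) (T^[j] (p k).1)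
      linarith)
    (by
      refine le_trans ?_ hcw.le
      refine le_trans (le_of_eq ?_) (ENNReal.tsum_comp_le_tsum_of_injective
        (f := fun k : κ => k.1) Subtype.val_injective (fun i => bowenWeight t (c i)))
      refine tsum_congr fun k => ?_
      rw [hp k]
      rfl)
    (by
      intro x hx
      simpa [K] using hx)
    M hM V hV hVc
  -- choose δ
  have hηpos : (0 : ℝ) < η := hη
  have hMa : (2 * M : ℝ≥0∞) ≤ (2 : ℝ≥0∞) ^ (((2 * M : ℕ) : ℝ)) := by
    rw [ENNReal.rpow_natCast]
    exact_mod_cast (Nat.lt_two_pow_self (n := 2 * M)).le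
  have hMpos : (0 : ℝ) < ((2 * M : ℕ) : ℝ) := by exact_mod_cast (by omega : 0 < 2 * M)
  obtain ⟨N, hN⟩ := visits_small T hT K hKc hK0 (η / (2 * ((2 * M : ℕ) : ℝ))) (by positivity)
  have hbound : ∀ n ≥ N, bowenC T univ (t + η) n (4 * ε) ≤
      (2 : ℝ≥0∞) ^ (-((η : ℝ) / 2 * n)) := by
    intro n hn
    have hcv := key n ⌊(η : ℝ) / (2 * ((2 * M : ℕ) : ℝ)) * n⌋₊
    have huniv : {x | visN T K n x ≤ ⌊(η : ℝ) / (2 * ((2 * M : ℕ) : ℝ)) * n⌋₊} = univ :=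
      eq_univ_of_forall fun x => Nat.le_floor (hN n hn x)
    rw [huniv] at hcv
    refine (hcv.bowenC_le η).trans ?_
    have hfl : ((⌊(η : ℝ) / (2 * ((2 * M : ℕ) : ℝ)) * n⌋₊ : ℕ) : ℝ) ≤
      (η : ℝ) / (2 * ((2 * M : ℕ) : ℝ)) * n := Nat.floor_le (by positivity)
    generalize ⌊(η : ℝ) / (2 * ((2 * M : ℕ) : ℝ)) * n⌋₊ = b at hfl
    generalize ((2 * M : ℕ) : ℝ) = a at hMa hMpos hfl
    calc _ ≤ (2 : ℝ≥0∞) ^ (-((η : ℝ) * n)) * ((2 : ℝ≥0∞) ^ a) ^ b := by gcongr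
      _ = (2 : ℝ≥0∞) ^ (-((η : ℝ) * n) + a * b) := by
          rw [two_rpow_add, ENNReal.rpow_mul, ENNReal.rpow_natCast]
      _ ≤ _ := by
          apply ENNReal.rpow_le_rpow_of_exponent_le (by norm_num)
          have h2 := mul_le_mul_of_nonneg_left hfl hMpos.le
          have h3 : a * ((η : ℝ) / (2 * a) * n) = η / 2 * n := by field_simp
          linarith
  have hlim : Tendsto (fun n : ℕ => (2 : ℝ≥0∞) ^ (-((η : ℝ) / 2 * n))) atTop (𝓝 0) := by
    have hq : ∀ n : ℕ, (2 : ℝ≥0∞) ^ (-((η : ℝ) / 2 * n)) = ((2 : ℝ≥0∞) ^ (-((η : ℝ) / 2))) ^ n := by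
      intro n
      rw [← ENNReal.rpow_natCast, ← ENNReal.rpow_mul]
      ring_nf
    simp only [hq]
    apply ENNReal.tendsto_pow_atTop_nhds_zero_of_lt_one
    exact ENNReal.rpow_lt_one_of_one_lt_of_neg (by norm_num) (by linarith)
  rw [← nonpos_iff_eq_zero]
  refine iSup_le fun n => ge_of_tendsto hlim ?_
  filter_upwards [eventually_ge_atTop (max n N)] with nn hnn
  exact (bowenC_mono_n T univ (t + η) (4 * ε) ((le_max_left _ _).trans hnn)).trans
    (hbound nn ((le_max_right _ _).trans hnn))

/-- a set of totally full measure carries full Bowen topological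
entropy. -/
theorem bowenEntropy_of_totally_full_measure (T : X → X) (hT : Continuous T)
    (Y : Set X)
    (hY : ∀ μ : Measure X, IsProbabilityMeasure μ → μ.map T = μ → μ Y = 1) :
    bowenEntropy T Y = bowenEntropy T Set.univ := by
  refine le_antisymm (bowenEntropy_mono_set T (subset_univ Y)) ?_
  refine iSup₂_le fun ε hε => ?_
  refine le_trans ?_ (le_iSup₂ (f := fun (ε : ℝ) (_ : 0 < ε) => bowenEntropyOf T Y ε)
    (ε / 4) (by positivity))
  refine le_iInf fun t => ?_
  refine ENNReal.le_of_forall_pos_le_add fun η hη _ => ?_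
  have h := bowenC_univ_zero T hT Y hY (ε / 4) (by positivity) t.1 t.2 η hη
  rw [show 4 * (ε / 4) = ε by ring] at h
  exact iInf_le_of_le ⟨t.1 + η, h⟩ (by simp)
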